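/- Let β > 0, d ∈ ℕ, let d⋆ ∈ (0, d], and let 0 < s < d⋆. Consider the class M_{d⋆} of all Borel probability measures μ on [0,1]^d whose lower Wasserstein dimension satisfies d_*(μ) ≤ d⋆. Then there exist c > 0 and n₀ ∈ ℕ such that for every n ≥ n₀ and every estimator — every map μ̂ from ([0,1]^d)^n to Borel probability measures on [0,1]^d, measurable with respect to the Borel σ-algebra of the weak topology — one has sup_{μ ∈ M_{d⋆}} E_{X_1,…,X_n i.i.d. μ} ‖μ̂(X_1,…,X_n) − μ‖_{H^β(ℝ^d,ℝ,1)} ≥ c n^{-β/s}. -/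

import Mathlib

open Filter Topology MeasureTheory Set
open scoped ENNReal NNReal

noncomputable section

/-- Minimal number of closed balls of radius `ε` needed to cover `S`. -/
def coverN {X : Type*} [PseudoMetricSpace X] (ε : ℝ) (S : Set X) : ℕ∞ :=
  ⨅ (t : Finset X) (_ : S ⊆ ⋃ x ∈ t, Metric.closedBall x ε), (t.card : ℕ∞)

/-- The `(ε,τ)`-covering number of a measure `μ`. -/
def measCoverN {X : Type*} [PseudoMetricSpace X] [MeasurableSpace X]
    (μ : Measure X) (ε τ : ℝ) : ℕ∞ :=
  ⨅ (S : Set X) (_ : MeasurableSet S) (_ : ENNReal.ofReal (1 - τ) ≤ μ S), coverN ε S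

/-- Extended logarithm `ℝ≥0∞ → EReal`. -/
def elog (x : ℝ≥0∞) : EReal :=
  if x = 0 then ⊥ else if x = ⊤ then ⊤ else ((Real.log x.toReal : ℝ) : EReal)

/-- `log N / log (1/ε)` as an extended real. -/
def dimRatio (N : ℕ∞) (ε : ℝ) : EReal :=
  elog (N : ℝ≥0∞) * (((Real.log (1 / ε))⁻¹ : ℝ) : EReal)

/-- The `α`-entropic dimension of a measure. -/
def entropicDim {X : Type*} [PseudoMetricSpace X] [MeasurableSpace X]
    (μ : Measure X) (α : ℝ) : EReal :=
  limsup (fun ε : ℝ => dimRatio (measCoverN μ ε (ε ^ α)) ε) (𝓝[>] (0 : ℝ))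

/-- The `α`-upper Wasserstein dimension of a measure. -/
def upperWDim {X : Type*} [PseudoMetricSpace X] [MeasurableSpace X]
    (μ : Measure X) (α : ℝ) : EReal :=
  sInf {x : EReal | ∃ s : ℝ, x = (s : EReal) ∧ 2 * α < s ∧
    limsup (fun ε : ℝ => dimRatio (measCoverN μ ε (ε ^ (s * α / (s - 2 * α)))) ε)
      (𝓝[>] (0 : ℝ)) ≤ (s : EReal)}

/-- The lower Wasserstein dimension of a measure. -/
def lowerWDim {X : Type*} [PseudoMetricSpace X] [MeasurableSpace X]
    (μ : Measure X) : EReal :=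
  limsup (fun τ : ℝ =>
    liminf (fun ε : ℝ => dimRatio (measCoverN μ ε τ) ε) (𝓝[>] (0 : ℝ))) (𝓝[>] (0 : ℝ))

/-- The support of a measure: points all of whose neighbourhoods have positive mass. -/
def msupport {X : Type*} [PseudoMetricSpace X] [MeasurableSpace X] (μ : Measure X) : Set X :=
  {x | ∀ r : ℝ, 0 < r → 0 < μ (Metric.ball x r)}

/-- The upper Minkowski dimension of (the support of) a measure. -/
def minkowskiDim {X : Type*} [PseudoMetricSpace X] [MeasurableSpace X]
    (μ : Measure X) : EReal :=
  limsup (fun ε : ℝ => dimRatio (coverN ε (msupport μ)) ε) (𝓝[>] (0 : ℝ))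

/-- The upper packing dimension of a measure. -/
def packingDim {X : Type*} [PseudoMetricSpace X] [MeasurableSpace X]
    (μ : Measure X) : EReal :=
  essSup (fun x =>
    limsup (fun r : ℝ => elog (μ (Metric.closedBall x r)) * (((Real.log r)⁻¹ : ℝ) : EReal))
      (𝓝[>] (0 : ℝ))) μ

/-- The lower regularity dimension of a measure. -/
def lowerRegDim {X : Type*} [PseudoMetricSpace X] [MeasurableSpace X]
    (μ : Measure X) : EReal :=
  sSup {x : EReal | ∃ s : ℝ, x = (s : EReal) ∧ ∃ C : ℝ, 0 < C ∧
    ∀ x0 ∈ msupport μ, ∀ r R : ℝ, 0 < r → r < R →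
      ENNReal.ofReal (C * (R / r) ^ s) ≤
        μ (Metric.closedBall x0 R) / μ (Metric.closedBall x0 r)}

/-- Partial derivative in coordinate `i`. -/
def pderiv' {d : ℕ} (i : Fin d) (f : (Fin d → ℝ) → ℝ) : (Fin d → ℝ) → ℝ :=
  fun x => fderiv ℝ f x (Pi.single i 1)

/-- Multi-index partial derivative `∂^s f`. -/
def mpderiv {d : ℕ} (s : Fin d → ℕ) (f : (Fin d → ℝ) → ℝ) : (Fin d → ℝ) → ℝ :=
  (List.finRange d).foldr (fun i g => (pderiv' i)^[s i] g) f

/-- The `β`-Hölder norm of `f : ℝ^d → ℝ` (with `ℓ∞` distances), valued in `ℝ≥0∞`. -/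
def holderNorm {d : ℕ} (β : ℝ) (f : (Fin d → ℝ) → ℝ) : ℝ≥0∞ :=
  (∑' s : {s : Fin d → ℕ // ∑ i, s i ≤ ⌊β⌋₊}, ⨆ x : Fin d → ℝ, (‖mpderiv s.1 f x‖₊ : ℝ≥0∞)) +
  ∑' s : {s : Fin d → ℕ // ∑ i, s i = ⌊β⌋₊}, ⨆ (x : Fin d → ℝ) (y : Fin d → ℝ) (_ : x ≠ y),
      (‖mpderiv s.1 f x - mpderiv s.1 f y‖₊ : ℝ≥0∞) / (nndist x y : ℝ≥0∞) ^ (β - (⌊β⌋₊ : ℝ))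

/-- The class `H^β(ℝ^d, ℝ, C)` of `β`-Hölder functions with norm at most `C`. -/
def HolderClass (d : ℕ) (β C : ℝ) : Set ((Fin d → ℝ) → ℝ) :=
  {f | ContDiff ℝ (⌊β⌋₊ : ℕ) f ∧ holderNorm β f ≤ ENNReal.ofReal C}

/-- The integral probability metric `‖P - Q‖_F`. -/
def ipm {X : Type*} [MeasurableSpace X] (F : Set (X → ℝ)) (P Q : Measure X) : ℝ :=
  ⨆ f : F, |∫ x, f.1 x ∂P - ∫ x, f.1 x ∂Q|

/-- The empirical measure of a sample `x : Fin n → X`. -/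
def empMeas {X : Type*} [MeasurableSpace X] {n : ℕ} (x : Fin n → X) : Measure X :=
  (n : ℝ≥0∞)⁻¹ • ∑ i : Fin n, Measure.dirac (x i)

/-- Total variation distance between two measures. -/
def tvDist {X : Type*} [MeasurableSpace X] (P Q : Measure X) : ℝ :=
  ⨆ A : {A : Set X // MeasurableSet A}, |(P A.1).toReal - (Q A.1).toReal|

end

open Filter Topology MeasureTheory Set
open scoped ENNReal

theorem elog_le_log {N : ℕ∞} {K : ℕ} (h : N ≤ K) :
    elog (N : ℝ≥0∞) ≤ ((Real.log K : ℝ) : EReal) := by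
  lift N to ℕ using ne_top_of_le_ne_top (ENat.natCast_ne_top K) h
  have h' : N ≤ K := by exact_mod_cast h
  rcases Nat.eq_zero_or_pos N with rfl | hN
  · simp [elog]
  · have h1 : ((N : ℕ∞) : ℝ≥0∞) = (N : ℝ≥0∞) := by simp
    rw [h1, elog, if_neg (by exact_mod_cast hN.ne'), if_neg (ENNReal.natCast_ne_top N),
      ENNReal.toReal_natCast]
    exact_mod_cast Real.log_le_log (by exact_mod_cast hN) (by exact_mod_cast h')

/-- A measure of mass at least one on a finite set has lower Wasserstein dimension at most `0`. -/
theorem lowerWDim_le_zero_of_finset {X : Type*} [PseudoMetricSpace X] [MeasurableSpace X]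
    [MeasurableSingletonClass X] (μ : Measure X) (t : Finset X) (ht : 1 ≤ μ t) :
    lowerWDim μ ≤ 0 := by
  refine Filter.limsup_le_of_le (h := ?_)
  filter_upwards [self_mem_nhdsWithin] with τ (hτ : 0 < τ)
  have hcov : ∀ ε : ℝ, 0 < ε → measCoverN μ ε τ ≤ (t.card : ℕ∞) := by
    intro ε hε
    refine (iInf_le_of_le (t : Set X) <| iInf_le_of_le t.measurableSet <|
      iInf_le_of_le ?_ <| iInf_le_of_le t <| iInf_le _ ?_)
    · exact (ENNReal.ofReal_le_one.2 (by linarith)).trans ht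
    · intro x hx
      exact Set.mem_biUnion (Finset.mem_coe.1 hx) (Metric.mem_closedBall_self hε.le)
  have hlog : Tendsto (fun ε : ℝ => Real.log (1 / ε)) (𝓝[>] 0) atTop := by
    simp only [one_div]
    exact Real.tendsto_log_atTop.comp tendsto_inv_nhdsGT_zero
  have hlim : Tendsto (fun ε : ℝ => ((Real.log t.card * (Real.log (1 / ε))⁻¹ : ℝ) : EReal))
      (𝓝[>] 0) (𝓝 0) := by
    have := (tendsto_inv_atTop_zero.comp hlog).const_mul (Real.log t.card)
    rw [mul_zero] at this
    exact (continuous_coe_real_ereal.tendsto 0).comp this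
  rw [← hlim.liminf_eq]
  refine liminf_le_liminf ?_
  filter_upwards [self_mem_nhdsWithin, hlog.eventually_ge_atTop 0] with ε hε h0
  rw [EReal.coe_mul]
  exact mul_le_mul_of_nonneg_right (elog_le_log (hcov ε hε)) (by exact_mod_cast inv_nonneg.2 h0)

section IPM

variable {X : Type*} [MeasurableSpace X] {F : Set (X → ℝ)}

theorem abs_integral_le_one {f : X → ℝ} (hf : ∀ x, |f x| ≤ 1) (P : Measure X)
    [IsProbabilityMeasure P] : |∫ x, f x ∂P| ≤ 1 := by
  simpa using norm_integral_le_of_norm_le_const (μ := P) (f := f) (C := 1) (.of_forall hf)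

theorem abs_integral_sub_integral_le_two {f : X → ℝ} (hf : ∀ x, |f x| ≤ 1) (P Q : Measure X)
    [IsProbabilityMeasure P] [IsProbabilityMeasure Q] : |∫ x, f x ∂P - ∫ x, f x ∂Q| ≤ 2 :=
  (abs_sub _ _).trans (by linarith [abs_integral_le_one hf P, abs_integral_le_one hf Q])

theorem bddAbove_ipm (hF : ∀ f ∈ F, ∀ x, |f x| ≤ 1) (P Q : Measure X)
    [IsProbabilityMeasure P] [IsProbabilityMeasure Q] :
    BddAbove (range fun f : F => |∫ x, f.1 x ∂P - ∫ x, f.1 x ∂Q|) :=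
  ⟨2, by rintro _ ⟨f, rfl⟩; exact abs_integral_sub_integral_le_two (hF f f.2) P Q⟩

theorem ipm_nonneg (P Q : Measure X) : 0 ≤ ipm F P Q :=
  Real.iSup_nonneg fun _ => abs_nonneg _

theorem ipm_le_two (hF : ∀ f ∈ F, ∀ x, |f x| ≤ 1) (P Q : Measure X)
    [IsProbabilityMeasure P] [IsProbabilityMeasure Q] : ipm F P Q ≤ 2 :=
  Real.iSup_le (fun f => abs_integral_sub_integral_le_two (hF f f.2) P Q) zero_le_two

theorem le_ipm (hF : ∀ f ∈ F, ∀ x, |f x| ≤ 1) (P Q : Measure X)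
    [IsProbabilityMeasure P] [IsProbabilityMeasure Q] {f : X → ℝ} (hf : f ∈ F) :
    |∫ x, f x ∂P - ∫ x, f x ∂Q| ≤ ipm F P Q :=
  le_ciSup (bddAbove_ipm hF P Q) ⟨f, hf⟩

theorem lowerSemicontinuous_ipm [TopologicalSpace X] [OpensMeasurableSpace X]
    (hc : ∀ f ∈ F, Continuous f) (hF : ∀ f ∈ F, ∀ x, |f x| ≤ 1) (Q : ProbabilityMeasure X) :
    LowerSemicontinuous fun P : ProbabilityMeasure X => ipm F (P : Measure X) (Q : Measure X) := by
  refine lowerSemicontinuous_ciSup (fun P => bddAbove_ipm hF _ _) fun f => ?_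
  have := ProbabilityMeasure.continuous_integral_boundedContinuousFunction
    (BoundedContinuousFunction.ofNormedAddCommGroup f.1 (hc f f.2) 1 (hF f f.2))
  exact (this.sub continuous_const).abs.lowerSemicontinuous

theorem measurable_ipm_comp [TopologicalSpace X] [OpensMeasurableSpace X]
    (hc : ∀ f ∈ F, Continuous f) (hF : ∀ f ∈ F, ∀ x, |f x| ≤ 1) (Q : ProbabilityMeasure X)
    {Y : Type*} [MeasurableSpace Y] {g : Y → ProbabilityMeasure X}
    (hg : @Measurable _ _ inferInstance (borel (ProbabilityMeasure X)) g) :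
    Measurable fun y => ipm F (g y : Measure X) (Q : Measure X) := by
  let _ : MeasurableSpace (ProbabilityMeasure X) := borel _
  have : BorelSpace (ProbabilityMeasure X) := ⟨rfl⟩
  exact (lowerSemicontinuous_ipm hc hF Q).measurable.comp hg

end IPM

section Assouad

/-- The uniform distribution on the values of `g`, as a pushforward. -/
noncomputable def uniformImage {ι X : Type*} [Fintype ι] [Nonempty ι] [MeasurableSpace ι]
    [MeasurableSpace X] (g : ι → X) : Measure X :=
  (PMF.uniformOfFintype ι).toMeasure.map g

variable {ι X : Type*} [Fintype ι] [Nonempty ι] [MeasurableSpace ι] [DiscreteMeasurableSpace ι]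
  [MeasurableSpace X]

instance (g : ι → X) : IsProbabilityMeasure (uniformImage g) :=
  Measure.isProbabilityMeasure_map (Measurable.of_discrete (f := g)).aemeasurable

theorem uniformImage_apply_eq_one (g : ι → X) {A : Set X} (hA : MeasurableSet A)
    (h : ∀ i, g i ∈ A) : uniformImage g A = 1 := by
  rw [uniformImage, Measure.map_apply .of_discrete hA, (eq_univ_of_forall h : g ⁻¹' A = univ),
    measure_univ]

theorem real_uniformOfFintype_singleton (i : ι) :
    (PMF.uniformOfFintype ι).toMeasure.real {i} = (Fintype.card ι : ℝ)⁻¹ := by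
  rw [measureReal_def, PMF.toMeasure_apply_singleton _ _ (measurableSet_singleton i)]
  simp

theorem integral_uniformImage (g : ι → X) {f : X → ℝ} (hf : Measurable f) :
    ∫ x, f x ∂(uniformImage g) = (Fintype.card ι : ℝ)⁻¹ * ∑ i, f (g i) := by
  rw [uniformImage, integral_map (Measurable.of_discrete).aemeasurable
    hf.stronglyMeasurable.aestronglyMeasurable, integral_fintype (.of_finite),
    Finset.mul_sum]
  simp only [real_uniformOfFintype_singleton, smul_eq_mul]

theorem integral_pi_uniformImage (n : ℕ) (g : ι → X) {f : (Fin n → X) → ℝ} (hf : Measurable f) :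
    ∫ x, f x ∂(Measure.pi fun _ : Fin n => uniformImage g) =
      ((Fintype.card ι : ℝ) ^ n)⁻¹ * ∑ J : Fin n → ι, f (fun i => g (J i)) := by
  have h := Measure.pi_map_pi (ι := Fin n) (μ := fun _ => (PMF.uniformOfFintype ι).toMeasure)
    (f := fun _ => g) (hμ := fun _ => by
      have : IsProbabilityMeasure ((PMF.uniformOfFintype ι).toMeasure.map g) :=
        inferInstanceAs (IsProbabilityMeasure (uniformImage g))
      infer_instance) (fun _ => (Measurable.of_discrete).aemeasurable)
  simp only [uniformImage]
  rw [← h, integral_map (Measurable.of_discrete).aemeasurable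
    hf.stronglyMeasurable.aestronglyMeasurable, integral_fintype (.of_finite),
    Finset.mul_sum]
  refine Finset.sum_congr rfl fun J _ => ?_
  rw [measureReal_def, Measure.pi_singleton, ENNReal.toReal_prod]
  simp only [← measureReal_def, real_uniformOfFintype_singleton, smul_eq_mul,
    Finset.prod_const, Finset.card_univ, Fintype.card_fin, inv_pow]

/-- Flip the bits of `σ` at the indices outside the range of `J`. -/
noncomputable def flipOutside {ι : Type*} {n : ℕ} (J : Fin n → ι) (σ : ι → Bool) : ι → Bool :=
  open Classical in fun j => if j ∈ range J then σ j else !σ j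

theorem flipOutside_involutive {ι : Type*} {n : ℕ} (J : Fin n → ι) :
    Function.Involutive (flipOutside J) := by
  intro σ
  funext j
  by_cases hj : j ∈ range J <;> simp [flipOutside, hj]

/-- If for every bit string `σ` the class `F` contains a function taking the value `h` at the points
`pt (j, σ j)` and `0` at the other points, then no estimator based on `n` observations achieves
an expected loss below `h / 4` for all uniform distributions on `{pt (j, σ j)}`, as soon as there
are at least `2 n` pairs. -/
theorem exists_le_integral_ipm [TopologicalSpace X] [OpensMeasurableSpace X] {F : Set (X → ℝ)}
    (hc : ∀ f ∈ F, Continuous f) (hF : ∀ f ∈ F, ∀ x, |f x| ≤ 1) (pt : ι × Bool → X) {h : ℝ}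
    (hh : 0 ≤ h)
    (hsep : ∀ σ : ι → Bool, ∃ f ∈ F, ∀ j b, f (pt (j, b)) = if b = σ j then h else 0)
    {n : ℕ} (hn : 2 * n ≤ Fintype.card ι) {muhat : (Fin n → X) → ProbabilityMeasure X}
    (hmu : @Measurable _ _ inferInstance (borel (ProbabilityMeasure X)) muhat) :
    ∃ σ : ι → Bool, h / 4 ≤ ∫ x : Fin n → X, ipm F (muhat x : Measure X)
      (uniformImage fun j => pt (j, σ j))
      ∂(Measure.pi fun _ => uniformImage fun j => pt (j, σ j)) := by
  classical
  set N : ℝ := (Fintype.card ι : ℝ) with hN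
  have hN0 : 0 < N := by rw [hN]; exact_mod_cast Fintype.card_pos
  have hnN : 2 * (n : ℝ) ≤ N := by rw [hN]; exact_mod_cast hn
  set g : (ι → Bool) → ι → X := fun σ j => pt (j, σ j) with hg
  set L : (ι → Bool) → (Fin n → ι) → ℝ := fun σ J =>
    ipm F (muhat fun i => g σ (J i) : Measure X) (uniformImage (g σ)) with hL
  have hpair : ∀ J σ, h / 2 ≤ L σ J + L (flipOutside J σ) J := by
    intro J σ
    obtain ⟨f, hfF, hf⟩ := hsep σ
    have hfm : Measurable f := (hc f hfF).measurable
    have hsame : (fun i => g (flipOutside J σ) (J i)) = fun i => g σ (J i) := by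
      funext i
      simp [hg, flipOutside]
    simp only [hL, hsame]
    have h1 := le_ipm hF (muhat fun i => g σ (J i) : Measure X) (uniformImage (g σ)) hfF
    have h2 := le_ipm hF (muhat fun i => g σ (J i) : Measure X)
      (uniformImage (g (flipOutside J σ))) hfF
    have hdiff : h / 2 ≤ ∫ x, f x ∂(uniformImage (g σ)) -
        ∫ x, f x ∂(uniformImage (g (flipOutside J σ))) := by
      rw [integral_uniformImage _ hfm, integral_uniformImage _ hfm, ← mul_sub,
        ← Finset.sum_sub_distrib]
      have hterm : ∀ j, f (g σ j) - f (g (flipOutside J σ) j) =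
          h - (if j ∈ Finset.univ.image J then h else 0) := by
        intro j
        by_cases hj : j ∈ range J
        · have hj' : j ∈ Finset.univ.image J := by simpa using hj
          simp [hg, flipOutside, hj, hj']
        · have hj' : j ∉ Finset.univ.image J := by simpa using hj
          simp only [hg, hf, flipOutside, if_neg hj, if_neg hj', if_true]
          simp
      have hcard : ((Finset.univ.image J).card : ℝ) ≤ n := by
        exact_mod_cast Finset.card_image_le.trans (by simp)
      rw [Finset.sum_congr rfl fun j _ => hterm j, Finset.sum_sub_distrib, Finset.sum_ite_mem,
        Finset.univ_inter, Finset.sum_const, Finset.sum_const, Finset.card_univ, nsmul_eq_mul,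
        nsmul_eq_mul, ← hN, inv_mul_eq_div, le_div_iff₀ hN0]
      nlinarith
    have h3 := le_abs_self (∫ x, f x ∂(muhat fun i => g σ (J i) : Measure X) -
      ∫ x, f x ∂(uniformImage (g (flipOutside J σ))))
    have h4 := neg_abs_le (∫ x, f x ∂(muhat fun i => g σ (J i) : Measure X) -
      ∫ x, f x ∂(uniformImage (g σ)))
    linarith
  have hJ : ∀ J, ∑ _σ : ι → Bool, h / 4 ≤ ∑ σ, L σ J := by
    intro J
    have hflip : ∑ σ, L (flipOutside J σ) J = ∑ σ, L σ J :=
      Equiv.sum_comp (flipOutside_involutive J).toPerm fun σ => L σ J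
    have hsum := Finset.sum_le_sum fun σ (_ : σ ∈ Finset.univ) => hpair J σ
    rw [Finset.sum_add_distrib, hflip] at hsum
    have hhalf : ∑ _σ : ι → Bool, h / 2 = 2 * ∑ _σ : ι → Bool, h / 4 := by
      rw [Finset.mul_sum]
      exact Finset.sum_congr rfl fun _ _ => by ring
    linarith
  have hint : ∀ σ, ∫ x : Fin n → X, ipm F (muhat x : Measure X) (uniformImage (g σ))
      ∂(Measure.pi fun _ => uniformImage (g σ)) = (N ^ n)⁻¹ * ∑ J : Fin n → ι, L σ J := fun σ =>
    integral_pi_uniformImage n (g σ)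
      (measurable_ipm_comp hc hF ⟨uniformImage (g σ), inferInstance⟩ hmu)
  obtain ⟨σ, -, hσ⟩ := Finset.exists_le_of_sum_le (s := (Finset.univ : Finset (ι → Bool)))
    (f := fun _ => h / 4) (g := fun σ => (N ^ n)⁻¹ * ∑ J : Fin n → ι, L σ J)
    Finset.univ_nonempty (by
      rw [← Finset.mul_sum, Finset.sum_comm]
      have := Finset.sum_le_sum fun J (_ : J ∈ (Finset.univ : Finset (Fin n → ι))) => hJ J
      rw [Finset.sum_const, Finset.card_univ, Fintype.card_fun, Fintype.card_fin, nsmul_eq_mul,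
        Nat.cast_pow, ← hN] at this
      rwa [inv_mul_eq_div, le_div_iff₀' (by positivity)])
  exact ⟨σ, hσ.trans_eq (hint σ).symm⟩

end Assouad

open scoped ContDiff

theorem coe_nnnorm_eq_ofReal_abs (r : ℝ) : (‖r‖₊ : ℝ≥0∞) = ENNReal.ofReal |r| := by
  rw [← enorm_eq_nnnorm, Real.enorm_eq_ofReal_abs]

section LatticeSum

variable {d : ℕ}

instance finite_multiIndex_le (k : ℕ) : Finite {s : Fin d → ℕ // ∑ i, s i ≤ k} := by
  apply Set.Finite.to_subtype
  refine (Set.finite_Iic (fun _ : Fin d => k)).subset fun s hs i => ?_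
  exact (Finset.single_le_sum (f := s) (fun _ _ => Nat.zero_le _) (Finset.mem_univ i)).trans hs

instance finite_multiIndex_eq (k : ℕ) : Finite {s : Fin d → ℕ // ∑ i, s i = k} := by
  apply Set.Finite.to_subtype
  exact (Set.finite_coe_iff.1 (finite_multiIndex_le (d := d) k)).subset fun s hs => le_of_eq hs

/-- The point of `ℝ^d` with the given integer coordinates. -/
def latticePt (p : Fin d → ℤ) : Fin d → ℝ := fun i => p i

/-- The sum of the translates of `ψ` to the lattice points in `S`, rescaled by `m`. -/
def latticeSum (m : ℝ) (S : Finset (Fin d → ℤ)) (ψ : (Fin d → ℝ) → ℝ) (x : Fin d → ℝ) : ℝ :=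
  ∑ p ∈ S, ψ (m • x - latticePt p)

/-- Smooth functions supported in the ball of radius `1/4` around the origin. -/
structure IsSmallBump (ψ : (Fin d → ℝ) → ℝ) : Prop where
  contDiff : ContDiff ℝ ∞ ψ
  tsupport_subset : tsupport ψ ⊆ Metric.closedBall 0 (1 / 4)

theorem latticePt_eq_of_norm_sub_le {u : Fin d → ℝ} {p q : Fin d → ℤ}
    (hp : ‖u - latticePt p‖ ≤ 1 / 4) (hq : ‖u - latticePt q‖ ≤ 1 / 4) : p = q := by
  funext i
  have h1 := (norm_le_pi_norm (u - latticePt p) i).trans hp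
  have h2 := (norm_le_pi_norm (u - latticePt q) i).trans hq
  simp only [latticePt, Pi.sub_apply, Real.norm_eq_abs, abs_le] at h1 h2
  have h3 : (p i : ℝ) < q i + 1 := by linarith
  have h4 : (q i : ℝ) < p i + 1 := by linarith
  norm_cast at h3 h4
  lia

theorem card_filter_norm_sub_le (S : Finset (Fin d → ℤ)) (u : Fin d → ℝ) :
    (S.filter fun p => ‖u - latticePt p‖ ≤ 1 / 4).card ≤ 1 :=
  Finset.card_le_one.2 fun _ hp _ hq =>
    latticePt_eq_of_norm_sub_le (Finset.mem_filter.1 hp).2 (Finset.mem_filter.1 hq).2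

namespace IsSmallBump

variable {ψ : (Fin d → ℝ) → ℝ}

theorem norm_le_of_ne_zero (hψ : IsSmallBump ψ) {x : Fin d → ℝ} (hx : ψ x ≠ 0) : ‖x‖ ≤ 1 / 4 :=
  mem_closedBall_zero_iff.1 (hψ.tsupport_subset (subset_tsupport ψ hx))

theorem hasCompactSupport (hψ : IsSmallBump ψ) : HasCompactSupport ψ :=
  (isCompact_closedBall _ _).of_isClosed_subset (isClosed_tsupport ψ) hψ.tsupport_subset

theorem pderiv' (hψ : IsSmallBump ψ) (i : Fin d) : IsSmallBump (_root_.pderiv' i ψ) where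
  contDiff := (hψ.contDiff.fderiv_right (m := ∞) (by simp)).clm_apply contDiff_const
  tsupport_subset := by
    refine (closure_mono ?_ : _ ⊆ tsupport (fderiv ℝ ψ)).trans
      ((tsupport_fderiv_subset ℝ).trans hψ.tsupport_subset)
    intro x hx h
    exact hx (by simp [_root_.pderiv', h])

theorem iterate_pderiv' (hψ : IsSmallBump ψ) (i : Fin d) (k : ℕ) :
    IsSmallBump ((_root_.pderiv' i)^[k] ψ) := by
  induction k with
  | zero => exact hψ
  | succ k ih => rw [Function.iterate_succ_apply']; exact ih.pderiv' i

theorem foldr_pderiv' (hψ : IsSmallBump ψ) (s : Fin d → ℕ) (l : List (Fin d)) :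
    IsSmallBump (l.foldr (fun i g => (_root_.pderiv' i)^[s i] g) ψ) := by
  induction l with
  | nil => exact hψ
  | cons i l ih => exact ih.iterate_pderiv' i (s i)

theorem mpderiv (hψ : IsSmallBump ψ) (s : Fin d → ℕ) : IsSmallBump (_root_.mpderiv s ψ) :=
  hψ.foldr_pderiv' s _

theorem contDiff_latticeSum (hψ : IsSmallBump ψ) (m : ℝ) (S : Finset (Fin d → ℤ)) :
    ContDiff ℝ ∞ (latticeSum m S ψ) :=
  ContDiff.sum fun _ _ => hψ.contDiff.comp ((contDiff_id.const_smul m).sub contDiff_const)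

theorem pderiv'_latticeSum (hψ : IsSmallBump ψ) (a m : ℝ) (S : Finset (Fin d → ℤ)) (i : Fin d) :
    _root_.pderiv' i (a • latticeSum m S ψ) =
      (a * m) • latticeSum m S (_root_.pderiv' i ψ) := by
  have hd : Differentiable ℝ ψ := hψ.contDiff.differentiable (by simp)
  funext x
  have hterm : ∀ p ∈ S, HasFDerivAt (fun y => ψ (m • y - latticePt p))
      ((fderiv ℝ ψ (m • x - latticePt p)).comp (m • ContinuousLinearMap.id ℝ (Fin d → ℝ))) x :=
    fun p _ => (hd _).hasFDerivAt.comp x (((hasFDerivAt_id x).const_smul m).sub_const _)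
  have hsum := (HasFDerivAt.fun_sum hterm).const_smul a
  have : _root_.pderiv' i (a • latticeSum m S ψ) x =
      (a • ∑ p ∈ S, (fderiv ℝ ψ (m • x - latticePt p)).comp
        (m • ContinuousLinearMap.id ℝ (Fin d → ℝ))) (Pi.single i 1) := by
    rw [_root_.pderiv']
    exact congrArg (fun A : (Fin d → ℝ) →L[ℝ] ℝ => A (Pi.single i 1)) hsum.fderiv
  rw [this]
  simp [latticeSum, _root_.pderiv', Finset.mul_sum, mul_assoc]

theorem iterate_pderiv'_latticeSum (hψ : IsSmallBump ψ) (a m : ℝ) (S : Finset (Fin d → ℤ))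
    (i : Fin d) (k : ℕ) : (_root_.pderiv' i)^[k] (a • latticeSum m S ψ) =
      (a * m ^ k) • latticeSum m S ((_root_.pderiv' i)^[k] ψ) := by
  induction k with
  | zero => simp
  | succ k ih =>
    rw [Function.iterate_succ_apply', Function.iterate_succ_apply', ih,
      (hψ.iterate_pderiv' i k).pderiv'_latticeSum, pow_succ, mul_assoc]

theorem foldr_pderiv'_latticeSum (hψ : IsSmallBump ψ) (a m : ℝ) (S : Finset (Fin d → ℤ))
    (s : Fin d → ℕ) (l : List (Fin d)) :
    l.foldr (fun i g => (_root_.pderiv' i)^[s i] g) (a • latticeSum m S ψ) =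
      (a * m ^ (l.map s).sum) •
        latticeSum m S (l.foldr (fun i g => (_root_.pderiv' i)^[s i] g) ψ) := by
  induction l with
  | nil => simp
  | cons i l ih =>
    rw [List.foldr_cons, ih, (hψ.foldr_pderiv' s l).iterate_pderiv'_latticeSum, List.foldr_cons,
      List.map_cons, List.sum_cons, mul_assoc, ← pow_add, add_comm]

theorem mpderiv_latticeSum (hψ : IsSmallBump ψ) (a m : ℝ) (S : Finset (Fin d → ℤ))
    (s : Fin d → ℕ) : _root_.mpderiv s (a • latticeSum m S ψ) =
      (a * m ^ ∑ i, s i) • latticeSum m S (_root_.mpderiv s ψ) := by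
  have h : ∑ i, s i = ((List.finRange d).map s).sum := (Fin.sum_univ_def s)
  rw [h]
  exact hψ.foldr_pderiv'_latticeSum a m S s _

theorem abs_latticeSum_le (hψ : IsSmallBump ψ) {B : ℝ} (hB : ∀ x, |ψ x| ≤ B) (m : ℝ)
    (S : Finset (Fin d → ℤ)) (x : Fin d → ℝ) : |latticeSum m S ψ x| ≤ B := by
  have hB0 : 0 ≤ B := (abs_nonneg _).trans (hB 0)
  have hsub : latticeSum m S ψ x =
      ∑ p ∈ S with ‖m • x - latticePt p‖ ≤ 1 / 4, ψ (m • x - latticePt p) := by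
    refine (Finset.sum_filter_of_ne fun p _ hp => hψ.norm_le_of_ne_zero hp).symm
  rw [hsub]
  refine (Finset.abs_sum_le_sum_abs _ _).trans
    ((Finset.sum_le_card_nsmul _ _ B fun p _ => hB _).trans ?_)
  rw [nsmul_eq_mul]
  exact mul_le_of_le_one_left hB0 (by exact_mod_cast card_filter_norm_sub_le S _)

theorem abs_latticeSum_sub_le (hψ : IsSmallBump ψ) {K : ℝ} {m : ℝ} {x y : Fin d → ℝ}
    (hK : ∀ p : Fin d → ℤ, |ψ (m • x - latticePt p) - ψ (m • y - latticePt p)| ≤ K)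
    (S : Finset (Fin d → ℤ)) : |latticeSum m S ψ x - latticeSum m S ψ y| ≤ 2 * K := by
  classical
  have hK0 : 0 ≤ K := (abs_nonneg _).trans (hK 0)
  have hsub : latticeSum m S ψ x - latticeSum m S ψ y =
      ∑ p ∈ S with ‖m • x - latticePt p‖ ≤ 1 / 4 ∨ ‖m • y - latticePt p‖ ≤ 1 / 4,
        (ψ (m • x - latticePt p) - ψ (m • y - latticePt p)) := by
    rw [latticeSum, latticeSum, ← Finset.sum_sub_distrib]
    refine (Finset.sum_filter_of_ne fun p _ hp => ?_).symm
    by_contra! hcon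
    have h1 := mt hψ.norm_le_of_ne_zero hcon.1.not_ge
    have h2 := mt hψ.norm_le_of_ne_zero hcon.2.not_ge
    rw [not_not] at h1 h2
    exact hp (by rw [h1, h2, sub_zero])
  rw [hsub, Finset.filter_or]
  refine (Finset.abs_sum_le_sum_abs _ _).trans
    ((Finset.sum_le_card_nsmul _ _ K fun p _ => hK p).trans ?_)
  rw [nsmul_eq_mul]
  refine mul_le_mul_of_nonneg_right ?_ hK0
  have h := (Finset.card_union_le _ _).trans
    (add_le_add (card_filter_norm_sub_le S (m • x)) (card_filter_norm_sub_le S (m • y)))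
  exact_mod_cast h

theorem exists_bound (hψ : IsSmallBump ψ) : ∃ B, 0 ≤ B ∧ ∀ x, |ψ x| ≤ B := by
  obtain ⟨B, hB⟩ := hψ.hasCompactSupport.exists_bound_of_continuous hψ.contDiff.continuous
  exact ⟨B, (norm_nonneg _).trans (hB 0), hB⟩

theorem exists_holder_bound (hψ : IsSmallBump ψ) {θ : ℝ} (h0 : 0 ≤ θ) (h1 : θ ≤ 1) :
    ∃ K, 0 ≤ K ∧ ∀ x y, |ψ x - ψ y| ≤ K * ‖x - y‖ ^ θ := by
  obtain ⟨B, hB0, hB⟩ := hψ.exists_bound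
  obtain ⟨C, hC⟩ := hψ.contDiff.lipschitzWith_of_hasCompactSupport hψ.hasCompactSupport (by simp)
  refine ⟨2 * B + C, by positivity, fun x y => ?_⟩
  rcases le_total ‖x - y‖ 1 with h | h
  · have hl : |ψ x - ψ y| ≤ C * ‖x - y‖ := by simpa [dist_eq_norm] using hC.dist_le_mul x y
    rcases (norm_nonneg (x - y)).eq_or_lt with hz | hz
    · rw [← hz, mul_zero] at hl
      exact hl.trans (by positivity)
    · have : ‖x - y‖ ≤ ‖x - y‖ ^ θ := by
        simpa using Real.rpow_le_rpow_of_exponent_ge hz h h1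
      refine hl.trans (mul_le_mul (by linarith) this hz.le (by positivity))
  · have : 1 ≤ ‖x - y‖ ^ θ := Real.one_le_rpow h h0
    calc |ψ x - ψ y| ≤ |ψ x| + |ψ y| := abs_sub _ _
      _ ≤ (2 * B + C) * 1 := by linarith [hB x, hB y, C.coe_nonneg]
      _ ≤ _ := by gcongr

theorem latticeSum_apply (hψ : IsSmallBump ψ) {m : ℝ} (S : Finset (Fin d → ℤ)) {x : Fin d → ℝ}
    {q : Fin d → ℤ} (hx : m • x = latticePt q) [Decidable (q ∈ S)] :
    latticeSum m S ψ x = if q ∈ S then ψ 0 else 0 := by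
  have hz : ∀ p ∈ S, p ≠ q → ψ (m • x - latticePt p) = 0 := by
    intro p _ hpq
    by_contra hne
    exact hpq (latticePt_eq_of_norm_sub_le (hψ.norm_le_of_ne_zero hne) (by simp [hx]))
  split_ifs with hq
  · rw [latticeSum, Finset.sum_eq_single_of_mem q hq hz, hx, sub_self]
  · exact Finset.sum_eq_zero fun p hp => hz p hp (by rintro rfl; exact hq hp)

/-- Rescaled lattice sums of a fixed bump lie in the Hölder unit ball after multiplication by
`c * m ^ (-β)`, uniformly in the scale and in the set of lattice points. -/
theorem exists_mem_holderClass (hψ : IsSmallBump ψ) {β : ℝ} (hβ : 0 < β) :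
    ∃ c > 0, ∀ m : ℝ, 1 ≤ m → ∀ S : Finset (Fin d → ℤ),
      (c * m ^ (-β)) • latticeSum m S ψ ∈ HolderClass d β 1 := by
  set k := ⌊β⌋₊ with hk
  have hkβ : (k : ℝ) ≤ β := Nat.floor_le hβ.le
  have hβk : β ≤ k + 1 := (Nat.lt_floor_add_one β).le
  choose B hB0 hB using fun s => (hψ.mpderiv s).exists_bound
  choose H hH0 hH using fun s =>
    (hψ.mpderiv s).exists_holder_bound (sub_nonneg.2 hkβ) (by linarith : β - k ≤ 1)
  have := Fintype.ofFinite {s : Fin d → ℕ // ∑ i, s i ≤ k}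
  have := Fintype.ofFinite {s : Fin d → ℕ // ∑ i, s i = k}
  set T : ℝ := ∑ s : {s : Fin d → ℕ // ∑ i, s i ≤ k}, B s +
    ∑ s : {s : Fin d → ℕ // ∑ i, s i = k}, 2 * H s with hT
  have hT0 : 0 ≤ T := add_nonneg (Finset.sum_nonneg fun s _ => hB0 s)
    (Finset.sum_nonneg fun s _ => mul_nonneg zero_le_two (hH0 s))
  set c := (1 + T)⁻¹ with hc
  have hc0 : 0 < c := by positivity
  refine ⟨c, hc0, fun m hm S => ⟨?_, ?_⟩⟩
  · exact ((hψ.contDiff_latticeSum m S).of_le (WithTop.coe_le_coe.2 le_top)).const_smul (c * m ^ (-β))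
  have hm0 : 0 < m := by linarith
  have hfirst : ∀ s : {s : Fin d → ℕ // ∑ i, s i ≤ k},
      ⨆ x : Fin d → ℝ,
        (‖_root_.mpderiv s.1 ((c * m ^ (-β)) • latticeSum m S ψ) x‖₊ : ℝ≥0∞) ≤
      ENNReal.ofReal (c * B s) := by
    intro s
    refine iSup_le fun x => ?_
    rw [coe_nnnorm_eq_ofReal_abs, hψ.mpderiv_latticeSum, Pi.smul_apply, smul_eq_mul, abs_mul,
      mul_assoc c, abs_of_nonneg (by positivity), mul_assoc c]
    refine ENNReal.ofReal_le_ofReal (mul_le_mul_of_nonneg_left ?_ hc0.le)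
    refine (mul_le_of_le_one_left (abs_nonneg _) ?_).trans
      ((hψ.mpderiv s).abs_latticeSum_le (hB s) m S x)
    rw [← Real.rpow_natCast, ← Real.rpow_add hm0]
    have hsk : ((∑ i, s.1 i : ℕ) : ℝ) ≤ k := by exact_mod_cast s.2
    exact Real.rpow_le_one_of_one_le_of_nonpos hm (by linarith)
  have hsecond : ∀ s : {s : Fin d → ℕ // ∑ i, s i = k},
      ⨆ (x : Fin d → ℝ) (y : Fin d → ℝ) (_ : x ≠ y),
        (‖_root_.mpderiv s.1 ((c * m ^ (-β)) • latticeSum m S ψ) x -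
          _root_.mpderiv s.1 ((c * m ^ (-β)) • latticeSum m S ψ) y‖₊ : ℝ≥0∞) /
          (nndist x y : ℝ≥0∞) ^ (β - (k : ℝ)) ≤ ENNReal.ofReal (c * (2 * H s)) := by
    intro s
    refine iSup_le fun x => iSup_le fun y => iSup_le fun hxy => ?_
    have hdist : 0 < ‖x - y‖ := norm_pos_iff.2 (sub_ne_zero.2 hxy)
    have hpow : (nndist x y : ℝ≥0∞) ^ (β - (k : ℝ)) =
        ENNReal.ofReal (‖x - y‖ ^ (β - (k : ℝ))) := by
      rw [← edist_nndist, edist_dist, dist_eq_norm, ENNReal.ofReal_rpow_of_pos hdist]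
    rw [coe_nnnorm_eq_ofReal_abs, hpow, ← ENNReal.ofReal_div_of_pos (by positivity)]
    refine ENNReal.ofReal_le_ofReal ((div_le_iff₀ (by positivity)).2 ?_)
    have hT := (hψ.mpderiv s).abs_latticeSum_sub_le (m := m) (x := x) (y := y)
      (K := H s * (m ^ (β - k) * ‖x - y‖ ^ (β - k))) (fun p => by
        refine (hH s _ _).trans_eq ?_
        rw [sub_sub_sub_cancel_right, ← smul_sub, norm_smul, Real.norm_of_nonneg hm0.le,
          Real.mul_rpow hm0.le hdist.le]) S
    have hone : m ^ (-β) * m ^ k * m ^ (β - k) = 1 := by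
      rw [← Real.rpow_natCast m k, ← Real.rpow_add hm0, ← Real.rpow_add hm0,
        show -β + k + (β - k) = 0 by ring, Real.rpow_zero]
    rw [hψ.mpderiv_latticeSum, Pi.smul_apply, Pi.smul_apply, ← smul_sub, smul_eq_mul, abs_mul,
      abs_of_nonneg (by positivity), s.2]
    calc c * m ^ (-β) * m ^ k * |latticeSum m S (_root_.mpderiv s ψ) x -
          latticeSum m S (_root_.mpderiv s ψ) y|
        ≤ c * m ^ (-β) * m ^ k * (2 * (H s * (m ^ (β - k) * ‖x - y‖ ^ (β - k)))) := by gcongr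
      _ = (m ^ (-β) * m ^ k * m ^ (β - k)) * (c * (2 * H s) * ‖x - y‖ ^ (β - k)) := by ring
      _ = c * (2 * H s) * ‖x - y‖ ^ (β - k) := by rw [hone, one_mul]
  have hsum : c * ∑ s : {s : Fin d → ℕ // ∑ i, s i ≤ k}, B s +
      c * ∑ s : {s : Fin d → ℕ // ∑ i, s i = k}, 2 * H s ≤ 1 := by
    rw [← mul_add, ← hT, hc, inv_mul_le_iff₀ (by linarith)]
    linarith
  rw [holderNorm, tsum_fintype, tsum_fintype]
  refine (add_le_add (Finset.sum_le_sum fun s _ => hfirst s)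
    (Finset.sum_le_sum fun s _ => hsecond s)).trans ?_
  rw [← ENNReal.ofReal_sum_of_nonneg fun s _ => mul_nonneg hc0.le (hB0 s.1),
    ← ENNReal.ofReal_sum_of_nonneg fun s _ => mul_nonneg hc0.le (mul_nonneg zero_le_two (hH0 s.1)),
    ← ENNReal.ofReal_add, ← Finset.mul_sum, ← Finset.mul_sum]
  · exact ENNReal.ofReal_le_ofReal hsum
  · exact Finset.sum_nonneg fun s _ => mul_nonneg hc0.le (hB0 s)
  · exact Finset.sum_nonneg fun s _ => mul_nonneg hc0.le (mul_nonneg zero_le_two (hH0 s))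

end IsSmallBump

theorem exists_isSmallBump (d : ℕ) : ∃ ψ : (Fin d → ℝ) → ℝ, IsSmallBump ψ ∧ ψ 0 = 1 := by
  let f : ContDiffBump (0 : Fin d → ℝ) := ⟨1 / 8, 1 / 4, by norm_num, by norm_num⟩
  exact ⟨f, ⟨f.contDiff, f.tsupport_eq.subset⟩,
    f.one_of_mem_closedBall (Metric.mem_closedBall_self (by norm_num [f]))⟩

end LatticeSum

theorem abs_le_one_of_mem_holderClass {d : ℕ} {β : ℝ} {f : (Fin d → ℝ) → ℝ}
    (hf : f ∈ HolderClass d β 1) (x : Fin d → ℝ) : |f x| ≤ 1 := by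
  have h0 : mpderiv (0 : Fin d → ℕ) f = f := by
    unfold mpderiv
    induction List.finRange d with
    | nil => rfl
    | cons i l ih => exact ih
  have h := (le_self_add.trans hf.2 : _ ≤ ENNReal.ofReal 1)
  have h1 := (ENNReal.le_tsum (⟨0, by simp⟩ : {s : Fin d → ℕ // ∑ i, s i ≤ ⌊β⌋₊})).trans h
  have h2 := (le_iSup (fun x => (‖mpderiv (0 : Fin d → ℕ) f x‖₊ : ℝ≥0∞)) x).trans h1
  rw [h0, coe_nnnorm_eq_ofReal_abs] at h2
  exact (ENNReal.ofReal_le_ofReal_iff zero_le_one).1 h2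

/-- Minimax lower bound over the class `M_{d⋆}` of Borel probability
measures on `[0,1]^d` whose lower Wasserstein dimension is at most `d⋆ ∈ (0, d]`:
for every `0 < s < d⋆` there are `c > 0` and `n₀` such that every (Borel-measurably chosen,
for the weak topology) estimator `μ̂` based on `n ≥ n₀` i.i.d. samples satisfies
`sup_{μ ∈ M_{d⋆}} E‖μ̂ − μ‖_{H^β(ℝ^d,ℝ,1)} ≥ c n^{-β/s}`. -/
theorem minimax_lower_bound_lowerWDim_class
    (d : ℕ) (β : ℝ) (hβ : 0 < β)
    (dstar : ℝ) (hdstar1 : 0 < dstar) (hdstar2 : dstar ≤ (d : ℝ))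
    (s : ℝ) (hs0 : 0 < s) (hs : s < dstar) :
    ∃ c > (0 : ℝ), ∃ n₀ : ℕ, ∀ n : ℕ, n₀ ≤ n →
      ∀ muhat : (Fin n → (Fin d → ℝ)) → ProbabilityMeasure (Fin d → ℝ),
        (∀ x, (muhat x : Measure (Fin d → ℝ)) (Set.Icc 0 1) = 1) →
        (@Measurable _ _ inferInstance (borel (ProbabilityMeasure (Fin d → ℝ))) muhat) →
        c * (n : ℝ) ^ (-(β / s)) ≤
          ⨆ μ : {μ : ProbabilityMeasure (Fin d → ℝ) //
              (μ : Measure (Fin d → ℝ)) (Set.Icc 0 1) = 1 ∧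
              lowerWDim (μ : Measure (Fin d → ℝ)) ≤ (dstar : EReal)},
            ∫ x : Fin n → (Fin d → ℝ),
              ipm (HolderClass d β 1) (muhat x : Measure (Fin d → ℝ))
                (μ.1 : Measure (Fin d → ℝ))
              ∂(Measure.pi fun _ => (μ.1 : Measure (Fin d → ℝ))) := by
  obtain ⟨ψ, hψ, hψ0⟩ := exists_isSmallBump d
  obtain ⟨c, hc, hmem⟩ := hψ.exists_mem_holderClass hβ
  refine ⟨c * 8 ^ (-β) / 4, by positivity, 1, fun n hn muhat _ hmu => ?_⟩
  have hcont : ∀ f ∈ HolderClass d β 1, Continuous f := fun f hf => hf.1.continuous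
  have hbdd : ∀ f ∈ HolderClass d β 1, ∀ x, |f x| ≤ 1 := fun f hf =>
    abs_le_one_of_mem_holderClass hf
  have hn1 : (1 : ℝ) ≤ n := by exact_mod_cast hn
  have hroot : 1 ≤ (n : ℝ) ^ (1 / s) := Real.one_le_rpow hn1 (by positivity)
  set m : ℕ := 4 * ⌈(n : ℝ) ^ (1 / s)⌉₊ with hm
  have hm4 : 4 * (n : ℝ) ^ (1 / s) ≤ m := by
    rw [hm]
    push_cast
    linarith [Nat.le_ceil ((n : ℝ) ^ (1 / s))]
  have hm8 : (m : ℝ) ≤ 8 * (n : ℝ) ^ (1 / s) := by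
    rw [hm]
    push_cast
    linarith [Nat.ceil_lt_add_one (zero_le_one.trans hroot)]
  have hm1 : (1 : ℝ) ≤ m := by linarith
  have hm0 : (0 : ℝ) < m := by linarith
  have hd : d ≠ 0 := by
    rintro rfl
    rw [Nat.cast_zero] at hdstar2
    linarith
  have hcard : 4 * n ≤ m ^ d := by
    have h1 : (4 * (n : ℝ) ^ (1 / s)) ^ d ≤ (m : ℝ) ^ d := by gcongr
    have h2 : (n : ℝ) ≤ ((n : ℝ) ^ (1 / s)) ^ d := by
      rw [← Real.rpow_natCast, ← Real.rpow_mul (by positivity)]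
      refine Real.self_le_rpow_of_one_le hn1 ?_
      rw [one_div, inv_mul_eq_div, one_le_div hs0]
      linarith
    have h3 : (4 : ℝ) ≤ 4 ^ d := le_self_pow₀ (by norm_num) hd
    rw [mul_pow] at h1
    have h4 : (4 : ℝ) * n ≤ 4 ^ d * ((n : ℝ) ^ (1 / s)) ^ d := by gcongr
    exact_mod_cast h4.trans h1
  obtain ⟨e⟩ := Function.Embedding.nonempty_of_card_le
    (α := Fin (2 * n) × Bool) (β := Fin d → Fin m) (by simp; lia)
  have : Nonempty (Fin (2 * n)) := ⟨⟨0, by lia⟩⟩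
  let z : Fin (2 * n) × Bool → Fin d → ℤ := fun q i => ((e q i : ℕ) : ℤ)
  have hz : Function.Injective z := fun q r hqr => e.injective <| funext fun i =>
    Fin.ext (Int.ofNat_inj.1 (congrFun hqr i))
  let pt : Fin (2 * n) × Bool → Fin d → ℝ := fun q => (m : ℝ)⁻¹ • latticePt (z q)
  have hpt : ∀ q, (m : ℝ) • pt q = latticePt (z q) := fun q => smul_inv_smul₀ hm0.ne' _
  have hptI : ∀ q, pt q ∈ Set.Icc (0 : Fin d → ℝ) 1 := by
    refine fun q => ⟨fun i => ?_, fun i => ?_⟩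
    · simp only [pt, z, latticePt, Pi.smul_apply, Pi.zero_apply, smul_eq_mul]
      positivity
    · simp only [pt, z, latticePt, Pi.smul_apply, Pi.one_apply, smul_eq_mul]
      rw [inv_mul_le_iff₀ hm0, mul_one]
      exact_mod_cast (e q i).2.le
  obtain ⟨σ, hσ⟩ := exists_le_integral_ipm hcont hbdd pt (h := c * (m : ℝ) ^ (-β))
    (by positivity) (fun σ => ⟨_, hmem m hm1 (Finset.univ.image fun j => z (j, σ j)), fun j b => by
      have hiff : z (j, b) ∈ Finset.univ.image (fun j => z (j, σ j)) ↔ b = σ j := by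
        simp only [Finset.mem_image, Finset.mem_univ, true_and, hz.eq_iff, Prod.mk.injEq]
        exact ⟨by rintro ⟨_, rfl, rfl⟩; rfl, fun h => ⟨j, rfl, h.symm⟩⟩
      rw [Pi.smul_apply, hψ.latticeSum_apply _ (hpt (j, b)), hψ0, smul_eq_mul]
      simp only [hiff, mul_ite, mul_one, mul_zero]⟩)
    (n := n) (by simp) hmu
  let ν : ProbabilityMeasure (Fin d → ℝ) := ⟨uniformImage fun j => pt (j, σ j), inferInstance⟩
  have hνI : (ν : Measure (Fin d → ℝ)) (Set.Icc 0 1) = 1 :=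
    uniformImage_apply_eq_one _ measurableSet_Icc fun j => hptI _
  have hνdim : lowerWDim (ν : Measure (Fin d → ℝ)) ≤ (dstar : EReal) := by
    refine (lowerWDim_le_zero_of_finset _ (Finset.univ.image fun j => pt (j, σ j))
      (uniformImage_apply_eq_one _ (Finset.measurableSet _) fun j => ?_).ge).trans
      (by exact_mod_cast hdstar1.le)
    simp
  refine le_trans ?_ (hσ.trans (le_ciSup (f := fun μ : {μ : ProbabilityMeasure (Fin d → ℝ) //
      (μ : Measure (Fin d → ℝ)) (Set.Icc 0 1) = 1 ∧
      lowerWDim (μ : Measure (Fin d → ℝ)) ≤ (dstar : EReal)} =>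
    ∫ x : Fin n → (Fin d → ℝ), ipm (HolderClass d β 1) (muhat x : Measure (Fin d → ℝ))
      (μ.1 : Measure (Fin d → ℝ)) ∂(Measure.pi fun _ => (μ.1 : Measure (Fin d → ℝ))))
    ⟨2, ?_⟩ ⟨ν, hνI, hνdim⟩))
  · have h1 : (8 : ℝ) ^ (-β) * (n : ℝ) ^ (-(β / s)) ≤ (m : ℝ) ^ (-β) := by
      have h2 : (n : ℝ) ^ (-(β / s)) = ((n : ℝ) ^ (1 / s)) ^ (-β) := by
        rw [← Real.rpow_mul (by positivity)]
        congr 1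
        ring
      rw [h2, ← Real.mul_rpow (by norm_num) (by positivity)]
      exact Real.rpow_le_rpow_of_nonpos hm0 hm8 (by linarith)
    have h3 := mul_le_mul_of_nonneg_left h1 hc.le
    linarith
  · rintro _ ⟨μ, rfl⟩
    have h := norm_integral_le_of_norm_le_const
      (μ := Measure.pi fun _ : Fin n => (μ.1 : Measure (Fin d → ℝ)))
      (f := fun x => ipm (HolderClass d β 1) (muhat x : Measure (Fin d → ℝ))
        (μ.1 : Measure (Fin d → ℝ))) (C := 2) (.of_forall fun x => by
        rw [Real.norm_of_nonneg (ipm_nonneg _ _)]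
        exact ipm_le_two hbdd _ _)
    exact (le_abs_self _).trans (by simpa using h)
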